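/- arXiv:2409.16456 — 4 statements merged into one kernel-verified Lean document; each statement's English description precedes it below -/
import Mathlib

section
/- Let N ≥ 1, let 0 < p ≤ 1, and let Ω = (Fin N → Bool) carry the product measure in which each coordinate is an independent Bernoulli(p) random variable (true with probability p). For ω ∈ Ω let S(ω) = {i : ω i = true}. Let x : Fin N → ℝ and define f(ω) = (N/|S(ω)|) · ∑_{i ∈ S(ω)} x i if S(ω) ≠ ∅, and f(ω) = 0 otherwise. Then the expectation of f equals (1 − (1−p)^N) · ∑_{i} x i. -/
open MeasureTheory

/-- The proportion of the `true` coordinates of `ω` that is carried by coordinate `i`. -/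
noncomputable def coordShare {ι : Type*} [Fintype ι] (i : ι) (ω : ι → Bool) : ℝ :=
  if ω i = true then ((Finset.univ.filter (fun j => ω j = true)).card : ℝ)⁻¹ else 0

lemma coordShare_comp_equiv {ι : Type*} [Fintype ι] (e : ι ≃ ι) (i : ι) (ω : ι → Bool) :
    coordShare i (ω ∘ e) = coordShare (e i) ω := by
  have h : (Finset.univ.filter (fun j => (ω ∘ e) j = true)).card =
      (Finset.univ.filter (fun j => ω j = true)).card :=
    Finset.card_equiv e (by simp)
  rw [coordShare, coordShare, h, Function.comp_apply]

lemma sum_mul_coordShare {ι : Type*} [Fintype ι] (x : ι → ℝ) (ω : ι → Bool) :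
    ∑ i, x i * coordShare i ω =
      ((Finset.univ.filter (fun j => ω j = true)).card : ℝ)⁻¹ *
        ∑ i ∈ Finset.univ.filter (fun j => ω j = true), x i := by
  simp only [coordShare, mul_ite, mul_zero, ← Finset.sum_filter, ← Finset.sum_mul]
  exact mul_comm _ _

lemma sum_coordShare {ι : Type*} [Fintype ι] (ω : ι → Bool) :
    ∑ i, coordShare i ω = 1 - ({fun _ => false} : Set (ι → Bool)).indicator 1 ω := by
  have h := sum_mul_coordShare 1 ω
  simp only [Pi.one_apply, one_mul, Finset.sum_const, nsmul_eq_mul, mul_one] at h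
  rw [h]
  by_cases hω : ω = fun _ => false
  · simp [hω]
  · obtain ⟨i, hi⟩ := Function.ne_iff.mp hω
    have : (Finset.univ.filter (fun j => ω j = true)).Nonempty := ⟨i, by simpa using hi⟩
    rw [inv_mul_cancel₀ (by exact_mod_cast this.card_pos.ne')]
    simp [hω]

lemma integral_coordShare_eq {ι : Type*} [Fintype ι] (ν : Measure Bool)
    [IsProbabilityMeasure ν] (i j : ι) :
    ∫ ω, coordShare i ω ∂(Measure.pi fun _ : ι => ν) =
      ∫ ω, coordShare j ω ∂(Measure.pi fun _ : ι => ν) := by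
  classical
  have h := (measurePreserving_piCongrLeft (fun _ : ι => ν) (Equiv.swap i j)).integral_comp'
    (coordShare i)
  rw [← h]
  congr 1 with ω
  have : MeasurableEquiv.piCongrLeft (fun _ : ι => Bool) (Equiv.swap i j) ω =
      ω ∘ Equiv.swap i j := by
    ext k
    obtain ⟨k, rfl⟩ := (Equiv.swap i j).surjective k
    rw [MeasurableEquiv.coe_piCongrLeft, Equiv.piCongrLeft_apply_apply]
    simp
  rw [this, coordShare_comp_equiv, Equiv.swap_apply_left]

lemma card_mul_integral_coordShare {ι : Type*} [Fintype ι] (ν : Measure Bool)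
    [IsProbabilityMeasure ν] (i : ι) :
    Fintype.card ι * ∫ ω, coordShare i ω ∂(Measure.pi fun _ : ι => ν) =
      1 - (1 - ν.real {true}) ^ Fintype.card ι := by
  have hfalse : ν.real {false} = 1 - ν.real {true} := by
    rw [← probReal_compl_eq_one_sub (measurableSet_singleton _)]
    congr 1
    ext b
    simp
  calc Fintype.card ι * ∫ ω, coordShare i ω ∂(Measure.pi fun _ : ι => ν)
      = ∑ j : ι, ∫ ω, coordShare j ω ∂(Measure.pi fun _ : ι => ν) := by
        simp [integral_coordShare_eq ν _ i]
    _ = ∫ ω, (1 - ({fun _ => false} : Set (ι → Bool)).indicator 1 ω) ∂(Measure.pi fun _ : ι => ν) := by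
        rw [← integral_finsetSum _ fun _ _ => Integrable.of_finite]
        simp only [sum_coordShare]
    _ = 1 - (1 - ν.real {true}) ^ Fintype.card ι := by
        rw [integral_sub Integrable.of_finite Integrable.of_finite,
          integral_indicator_one (measurableSet_singleton _), ← hfalse]
        simp [measureReal_def, Measure.pi_singleton]

/-- Packet-erasure aggregation (Lemma 1): with `N` independent Bernoulli(p) coordinates,
letting `S ω` be the set of `true` coordinates, the expectation of
`ω ↦ (N / |S ω|) * ∑_{i ∈ S ω} x i` (with value `0` when `S ω = ∅`) equals
`(1 - (1 - p)^N) * ∑ i, x i`. -/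
theorem stmt_2 (N : ℕ) (hN : 1 ≤ N) (p : ℝ) (hp0 : 0 < p) (hp1 : p ≤ 1)
    (ν : Measure Bool) [IsProbabilityMeasure ν] (hν : ν {true} = ENNReal.ofReal p)
    (x : Fin N → ℝ) (S : (Fin N → Bool) → Finset (Fin N))
    (hS : ∀ ω, S ω = Finset.univ.filter (fun i => ω i = true))
    (f : (Fin N → Bool) → ℝ)
    (hf : ∀ ω, f ω = if (S ω).Nonempty
        then ((N : ℝ) / ((S ω).card : ℝ)) * ∑ i ∈ S ω, x i else 0) :
    ∫ ω, f ω ∂(Measure.pi fun _ : Fin N => ν) = (1 - (1 - p) ^ N) * ∑ i, x i := by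
  have hf' : f = fun ω => ∑ i, (N * x i) * coordShare i ω := by
    ext ω
    rw [hf, hS]
    split_ifs with h
    · simp only [mul_assoc, ← Finset.mul_sum, sum_mul_coordShare, div_eq_mul_inv]
    · simp only [mul_assoc, ← Finset.mul_sum, sum_mul_coordShare,
        Finset.not_nonempty_iff_eq_empty.mp h, Finset.sum_empty, mul_zero]
  have hp : ν.real {true} = p := by
    rw [measureReal_def, hν, ENNReal.toReal_ofReal hp0.le]
  rw [hf', integral_finsetSum _ fun _ _ => Integrable.of_finite, Finset.mul_sum]
  refine Finset.sum_congr rfl fun i _ => ?_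
  have h := card_mul_integral_coordShare ν i
  rw [Fintype.card_fin, hp] at h
  rw [integral_const_mul, ← h]
  ring
end

section
/- Let N ≥ 1, let 0 < p ≤ 1, and let Ω = (Fin N → Bool) carry the product measure in which each coordinate is an independent Bernoulli(p) random variable (true with probability p). For ω ∈ Ω let S(ω) = {i : ω i = true}. Let z : Fin N → ℝ and define g(ω) = (1/|S(ω)|) · ∑_{i ∈ S(ω)} z i if S(ω) ≠ ∅, and g(ω) = 0 otherwise. Then the expectation of g equals ((1 − (1−p)^N)/N) · ∑_{i} z i. -/
open MeasureTheory

/-- The inclusion weights `∑ ω, (∏ j, w (ω j)) * (𝟙[ω i] / #{j | ω j})` do not depend on `i`. -/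
theorem sum_prod_mul_inclusion_div_card_eq {ι : Type*} [Fintype ι] [DecidableEq ι]
    (w : Bool → ℝ) (i k : ι) :
    ∑ ω : ι → Bool, (∏ j, w (ω j)) *
        ((if ω i = true then 1 else 0) / ((Finset.univ.filter fun j => ω j = true).card : ℝ))
      = ∑ ω : ι → Bool, (∏ j, w (ω j)) *
        ((if ω k = true then 1 else 0) /
          ((Finset.univ.filter fun j => ω j = true).card : ℝ)) := by
  refine Fintype.sum_equiv ((Equiv.swap i k).arrowCongr (Equiv.refl Bool)) _ _ fun ω => ?_
  have hprod : ∏ j, w (ω (Equiv.swap i k j)) = ∏ j, w (ω j) :=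
    Equiv.prod_comp (Equiv.swap i k) fun j => w (ω j)
  have hcard : (Finset.univ.filter fun j => ω (Equiv.swap i k j) = true).card
      = (Finset.univ.filter fun j => ω j = true).card := by
    simp only [Finset.card_filter]
    exact Equiv.sum_comp (Equiv.swap i k) fun j => if ω j = true then 1 else 0
  simp [hprod, hcard]

/-- The inclusion weights add up to the probability that some coordinate is `true`. -/
theorem sum_sum_prod_mul_inclusion_div_card {ι : Type*} [Fintype ι] [DecidableEq ι]
    (w : Bool → ℝ) (hw : w true + w false = 1) :
    ∑ i : ι, ∑ ω : ι → Bool, (∏ j, w (ω j)) *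
        ((if ω i = true then 1 else 0) / ((Finset.univ.filter fun j => ω j = true).card : ℝ))
      = 1 - w false ^ Fintype.card ι := by
  have htotal : ∑ ω : ι → Bool, ∏ j, w (ω j) = 1 := by
    rw [← Fintype.piFinset_univ, ← Finset.prod_univ_sum]
    simp [hw]
  have hpoint (ω : ι → Bool) : ∑ i : ι, (∏ j, w (ω j)) *
        ((if ω i = true then 1 else 0) / ((Finset.univ.filter fun j => ω j = true).card : ℝ))
      = (∏ j, w (ω j)) - if ω = fun _ => false then w false ^ Fintype.card ι else 0 := by
    rw [← Finset.mul_sum, ← Finset.sum_div, Finset.sum_boole]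
    split_ifs with h
    · simp [h]
    · have hne : (Finset.univ.filter fun j => ω j = true).Nonempty := by
        obtain ⟨j, hj⟩ := Function.ne_iff.mp h
        exact ⟨j, by simpa using hj⟩
      rw [div_self (by exact_mod_cast hne.card_pos.ne'), mul_one, sub_zero]
  rw [Finset.sum_comm]
  simp only [hpoint, Finset.sum_sub_distrib, htotal, Finset.sum_ite_eq', Finset.mem_univ, if_true]

theorem sum_prod_mul_inclusion_div_card {ι : Type*} [Fintype ι] [DecidableEq ι]
    (w : Bool → ℝ) (hw : w true + w false = 1) (i : ι) :
    ∑ ω : ι → Bool, (∏ j, w (ω j)) *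
        ((if ω i = true then 1 else 0) / ((Finset.univ.filter fun j => ω j = true).card : ℝ))
      = (1 - w false ^ Fintype.card ι) / Fintype.card ι := by
  have : Nonempty ι := ⟨i⟩
  rw [eq_div_iff (by exact_mod_cast Fintype.card_ne_zero),
    ← sum_sum_prod_mul_inclusion_div_card w hw,
    Finset.sum_congr rfl fun k _ => sum_prod_mul_inclusion_div_card_eq w k i,
    Finset.sum_const, Finset.card_univ, nsmul_eq_mul, mul_comm]


/-- With `N` independent Bernoulli(p) coordinates and `S ω` the set of `true`
coordinates, the expectation of `ω ↦ (1 / |S ω|) * ∑_{i ∈ S ω} z i` (with value `0`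
when `S ω = ∅`) equals `((1 - (1 - p)^N) / N) * ∑ i, z i`. -/
theorem stmt_4 (N : ℕ) (hN : 1 ≤ N) (p : ℝ) (hp0 : 0 < p) (hp1 : p ≤ 1)
    (ν : Measure Bool) [IsProbabilityMeasure ν] (hν : ν {true} = ENNReal.ofReal p)
    (z : Fin N → ℝ) (S : (Fin N → Bool) → Finset (Fin N))
    (hS : ∀ ω, S ω = Finset.univ.filter (fun i => ω i = true))
    (g : (Fin N → Bool) → ℝ)
    (hg : ∀ ω, g ω = if (S ω).Nonempty
        then (1 / ((S ω).card : ℝ)) * ∑ i ∈ S ω, z i else 0) :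
    ∫ ω, g ω ∂(Measure.pi fun _ : Fin N => ν)
      = ((1 - (1 - p) ^ N) / (N : ℝ)) * ∑ i, z i := by
  have hw_true : ν.real {true} = p := by
    rw [measureReal_def, hν, ENNReal.toReal_ofReal hp0.le]
  have hw : ν.real {true} + ν.real {false} = 1 := by
    have h := probReal_univ (μ := ν)
    rw [← Finset.coe_univ, ← sum_measureReal_singleton] at h
    simpa using h
  have hw_false : ν.real {false} = 1 - p := by linarith
  have hg_sum (ω : Fin N → Bool) : g ω = ∑ i, z i * ((if ω i = true then 1 else 0) /
      ((Finset.univ.filter fun j => ω j = true).card : ℝ)) := by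
    rw [hg, hS]
    split_ifs with h
    · rw [Finset.sum_filter, Finset.mul_sum]
      refine Finset.sum_congr rfl fun i _ => ?_
      split_ifs <;> ring
    · simp [Finset.not_nonempty_iff_eq_empty.mp h]
  have hμ (ω : Fin N → Bool) :
      (Measure.pi fun _ : Fin N => ν).real {ω} = ∏ j, ν.real {ω j} := by
    simp [measureReal_def, Measure.pi_singleton, ENNReal.toReal_prod]
  rw [integral_fintype .of_finite]
  simp only [hμ, hg_sum, smul_eq_mul, Finset.mul_sum]
  rw [Finset.sum_comm]
  refine Finset.sum_congr rfl fun i _ => ?_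
  have h := sum_prod_mul_inclusion_div_card (fun b => ν.real {b}) hw i
  simp only [hw_false, Fintype.card_fin] at h
  rw [← h, Finset.sum_mul]
  exact Finset.sum_congr rfl fun ω _ => by ring
end

section
/- Let a : ℕ → ℝ be a sequence with a k > 0 for all k, a k → 0, ∑_k a k = ∞ (not summable), and (a k²) summable. Let v : ℕ → ℝ satisfy v k ≥ 0 for all k and v (k+1) ≥ v k − C · a k for all k, for some constant C > 0. If (a k · (v k)²) is summable, then v k → 0 as k → ∞. -/
open Finset in
/-- A sequence with `v (k + 1) ≥ v k - C * a k` drops between two indices by at most `C` times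
the sum of `a` over that range. -/
theorem sub_mul_sum_le_of_sub_mul_le_succ {a v : ℕ → ℝ} {C : ℝ}
    (hrec : ∀ k, v (k + 1) ≥ v k - C * a k) {k n : ℕ} (hkn : k ≤ n) :
    v k - C * (∑ i ∈ range n, a i - ∑ i ∈ range k, a i) ≤ v n := by
  induction n, hkn using Nat.le_induction with
  | base => simp
  | succ n _ ih =>
    rw [sum_range_succ]
    linarith [hrec n]


/-- Sequence lemma for the convergence proof: if `a k > 0`, `a k → 0`, `∑ a k = ∞`,
`(a k ^ 2)` summable, `v k ≥ 0`, `v (k+1) ≥ v k - C * a k` for some `C > 0`, and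
`(a k * (v k)^2)` is summable, then `v k → 0`. -/
theorem stmt_13 (a : ℕ → ℝ) (ha : ∀ k, 0 < a k)
    (ha0 : Filter.Tendsto a Filter.atTop (nhds 0))
    (hadiv : ¬ Summable a) (hasq : Summable (fun k => (a k) ^ 2))
    (v : ℕ → ℝ) (hv : ∀ k, 0 ≤ v k)
    (C : ℝ) (hC : 0 < C) (hrec : ∀ k, v (k + 1) ≥ v k - C * a k)
    (hsum : Summable (fun k => a k * (v k) ^ 2)) :
    Filter.Tendsto v Filter.atTop (nhds 0) := by
  classical
  have hS : Filter.Tendsto (fun n => ∑ i ∈ Finset.range n, a i) Filter.atTop Filter.atTop :=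
    (not_summable_iff_tendsto_nat_atTop_of_nonneg fun k => (ha k).le).1 hadiv
  have hnonneg : ∀ k, 0 ≤ a k * v k ^ 2 := fun k => mul_nonneg (ha k).le (sq_nonneg _)
  rw [Metric.tendsto_nhds]
  intro ε hε
  have hη : 0 < (ε / 2) ^ 2 * (ε / (2 * C)) := by positivity
  filter_upwards [hsum.hasSum.tendsto_sum_nat.eventually_const_lt (sub_lt_self _ hη)] with k hk
  rw [Real.dist_eq, sub_zero, abs_of_nonneg (hv k)]
  by_contra! hvk
  have hex : ∃ n, ε / (2 * C) + ∑ i ∈ Finset.range k, a i < ∑ i ∈ Finset.range n, a i :=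
    (hS.eventually_gt_atTop _).exists
  -- the first time the partial sums of `a` have grown by more than `ε / (2 * C)` since `k`
  set n := Nat.find hex with hn
  have hspec := Nat.find_spec hex
  rw [← hn] at hspec
  have hδ : 0 < ε / (2 * C) := by positivity
  have hkn : k ≤ n := by
    by_contra! h
    have := Finset.sum_le_sum_of_subset_of_nonneg (Finset.range_mono h.le)
      fun i _ _ => (ha i).le
    linarith
  have hlow : ∀ j ∈ Finset.Ico k n, (ε / 2) ^ 2 * a j ≤ a j * v j ^ 2 := by
    intro j hj
    obtain ⟨hkj, hjn⟩ := Finset.mem_Ico.1 hj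
    have hmin := not_lt.1 (Nat.find_min hex hjn)
    have hdrop := sub_mul_sum_le_of_sub_mul_le_succ hrec hkj
    have hmul : C * (∑ i ∈ Finset.range j, a i - ∑ i ∈ Finset.range k, a i) ≤ ε / 2 := by
      calc _ ≤ C * (ε / (2 * C)) := mul_le_mul_of_nonneg_left (by linarith) hC.le
        _ = ε / 2 := by field_simp
    rw [mul_comm]
    exact mul_le_mul_of_nonneg_left (pow_le_pow_left₀ (by positivity) (by linarith) 2) (ha j).le
  have hsumlow := Finset.sum_le_sum hlow
  rw [← Finset.mul_sum, Finset.sum_Ico_eq_sub _ hkn, Finset.sum_Ico_eq_sub _ hkn] at hsumlow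
  have hgrow : (ε / 2) ^ 2 * (ε / (2 * C)) ≤
      (ε / 2) ^ 2 * (∑ i ∈ Finset.range n, a i - ∑ i ∈ Finset.range k, a i) :=
    mul_le_mul_of_nonneg_left (by linarith) (sq_nonneg _)
  linarith [hsum.sum_le_tsum (Finset.range n) fun i _ => hnonneg i]
end

section
/- Let υ₁, υ₂ > 0 with υ₃ := υ₁ + υ₂ < 1, υ₁ + 3υ₂ > 1, and 2υ₃ > 1. Let α₀, γ₀ > 0 and define α_k = α₀(1+k)^{−υ₁}, γ_k = γ₀(1+k)^{−υ₂}. Let c₁, c₂, c₃, L, δ₀ > 0 and let u : ℕ → ℝ with u k ≥ 0 satisfy, for every K ≥ 0, ∑_{k=0}^{K} α_k γ_k u_k ≤ (2/c₁)δ₀ + c₃² ∑_{k=0}^{K} α_k γ_k³ + (c₂L/c₁) ∑_{k=0}^{K} α_k² γ_k². Then for every K ≥ 0: (∑_{k=0}^{K} α_k γ_k u_k)/(∑_{k=0}^{K} α_k γ_k) ≤ ((1−υ₃)/((K+2)^{1−υ₃} − 1)) · (A₀ + A₁/(υ₁+3υ₂−1) + A₂/(2υ₃−1)), where A₀ = 2δ₀/(c₁α₀γ₀),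 A₁ = (υ₁+3υ₂)(c₃γ₀)², and A₂ = 2υ₃c₂α₀γ₀L/c₁. -/
/-- The integral of `x ^ (-p)` over `[1, 1 + n]`. -/
theorem integral_one_rpow_neg {p : ℝ} (hp : p ≠ 1) (n : ℕ) :
    ∫ x in (1 : ℝ)..1 + n, x ^ (-p) = (((1 : ℝ) + n) ^ (1 - p) - 1) / (1 - p) := by
  rw [integral_rpow, Real.one_rpow, neg_add_eq_sub]
  refine Or.inr ⟨fun h => hp (by linarith), ?_⟩
  rw [Set.uIcc_of_le (by linarith [n.cast_nonneg (α := ℝ)])]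
  exact fun h => absurd h.1 (by norm_num)

theorem antitoneOn_rpow_neg_Icc_one {p : ℝ} (hp : 0 ≤ p) (b : ℝ) :
    AntitoneOn (fun x : ℝ => x ^ (-p)) (Set.Icc 1 b) := fun _ hx _ _ hxy =>
  Real.rpow_le_rpow_of_nonpos (zero_lt_one.trans_le hx.1) hxy (neg_nonpos.mpr hp)

theorem sum_rpow_neg_ge {p : ℝ} (hp : 0 ≤ p) (hp1 : p ≠ 1) (n : ℕ) :
    (((1 : ℝ) + n) ^ (1 - p) - 1) / (1 - p) ≤ ∑ k ∈ Finset.range n, ((1 : ℝ) + k) ^ (-p) := by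
  rw [← integral_one_rpow_neg hp1]
  exact (antitoneOn_rpow_neg_Icc_one hp _).integral_le_sum

theorem sum_rpow_neg_le {p : ℝ} (hp : 1 < p) (n : ℕ) :
    ∑ k ∈ Finset.range (n + 1), ((1 : ℝ) + k) ^ (-p) ≤ p / (p - 1) := by
  have h := (antitoneOn_rpow_neg_Icc_one (zero_le_one.trans hp.le) (1 + n)).sum_le_integral
  rw [integral_one_rpow_neg hp.ne'] at h
  have hpos : (0 : ℝ) ≤ ((1 : ℝ) + n) ^ (1 - p) := by positivity
  have hp' : 0 < p - 1 := sub_pos.mpr hp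
  have hbound : (((1 : ℝ) + n) ^ (1 - p) - 1) / (1 - p) ≤ 1 / (p - 1) := by
    rw [← neg_div_neg_eq, neg_sub 1 p]
    gcongr
    linarith
  have hsplit : p / (p - 1) = 1 / (p - 1) + 1 := by field_simp; ring
  rw [Finset.sum_range_succ', hsplit]
  simp only [Nat.cast_zero, add_zero, Real.one_rpow]
  linarith


/-- Convergence rate (Theorem 2, case `υ₁ + υ₂ < 1`): under polynomial step sizes
`α k = α₀ (1+k)^(-υ₁)`, `γ k = γ₀ (1+k)^(-υ₂)` and the per-horizon inequality on the
weighted sums of `u`, the weighted average of `u` is bounded by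
`(1 - υ₃)/((K+2)^(1-υ₃) - 1) * (A₀ + A₁/(υ₁+3υ₂-1) + A₂/(2υ₃-1))`. -/
theorem stmt_14 (υ₁ υ₂ : ℝ) (h1 : 0 < υ₁) (h2 : 0 < υ₂)
    (h3 : υ₁ + υ₂ < 1) (h4 : 1 < υ₁ + 3 * υ₂) (h5 : 1 < 2 * (υ₁ + υ₂))
    (α₀ γ₀ c₁ c₂ c₃ L δ₀ : ℝ) (hα₀ : 0 < α₀) (hγ₀ : 0 < γ₀)
    (hc₁ : 0 < c₁) (hc₂ : 0 < c₂) (hc₃ : 0 < c₃) (hL : 0 < L) (hδ₀ : 0 < δ₀)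
    (α γ : ℕ → ℝ)
    (hα : ∀ k : ℕ, α k = α₀ * ((1 : ℝ) + k) ^ (-υ₁))
    (hγ : ∀ k : ℕ, γ k = γ₀ * ((1 : ℝ) + k) ^ (-υ₂))
    (u : ℕ → ℝ) (hu : ∀ k, 0 ≤ u k)
    (hineq : ∀ K : ℕ,
      ∑ k ∈ Finset.range (K + 1), α k * γ k * u k
        ≤ 2 / c₁ * δ₀ + c₃ ^ 2 * ∑ k ∈ Finset.range (K + 1), α k * (γ k) ^ 3
          + c₂ * L / c₁ * ∑ k ∈ Finset.range (K + 1), (α k) ^ 2 * (γ k) ^ 2) :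
    ∀ K : ℕ,
      (∑ k ∈ Finset.range (K + 1), α k * γ k * u k)
          / (∑ k ∈ Finset.range (K + 1), α k * γ k)
        ≤ (1 - (υ₁ + υ₂)) / (((K : ℝ) + 2) ^ (1 - (υ₁ + υ₂)) - 1)
          * (2 * δ₀ / (c₁ * α₀ * γ₀)
            + (υ₁ + 3 * υ₂) * (c₃ * γ₀) ^ 2 / (υ₁ + 3 * υ₂ - 1)
            + 2 * (υ₁ + υ₂) * c₂ * α₀ * γ₀ * L / c₁ / (2 * (υ₁ + υ₂) - 1)) := by
  intro K
  have hpow (k : ℕ) (a : ℝ) (n : ℕ) :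
      (((1 : ℝ) + k) ^ (-a)) ^ n = ((1 : ℝ) + k) ^ (-(n * a)) := by
    rw [← Real.rpow_natCast, ← Real.rpow_mul (by positivity)]
    congr 1
    ring
  have hmul (k : ℕ) (a b : ℝ) :
      ((1 : ℝ) + k) ^ (-a) * ((1 : ℝ) + k) ^ (-b) = ((1 : ℝ) + k) ^ (-(a + b)) := by
    rw [← Real.rpow_add (by positivity), neg_add]
  have hsum : ∑ k ∈ Finset.range (K + 1), α k * γ k
      = α₀ * γ₀ * ∑ k ∈ Finset.range (K + 1), ((1 : ℝ) + k) ^ (-(υ₁ + υ₂)) := by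
    rw [Finset.mul_sum]
    refine Finset.sum_congr rfl fun k _ => ?_
    rw [hα, hγ, ← hmul]
    ring
  have hsum₁ : ∑ k ∈ Finset.range (K + 1), α k * (γ k) ^ 3
      = α₀ * γ₀ ^ 3 * ∑ k ∈ Finset.range (K + 1), ((1 : ℝ) + k) ^ (-(υ₁ + 3 * υ₂)) := by
    rw [Finset.mul_sum]
    refine Finset.sum_congr rfl fun k _ => ?_
    rw [hα, hγ, ← hmul, mul_pow, hpow]
    push_cast
    ring
  have hsum₂ : ∑ k ∈ Finset.range (K + 1), (α k) ^ 2 * (γ k) ^ 2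
      = α₀ ^ 2 * γ₀ ^ 2 * ∑ k ∈ Finset.range (K + 1), ((1 : ℝ) + k) ^ (-(2 * (υ₁ + υ₂))) := by
    rw [Finset.mul_sum]
    refine Finset.sum_congr rfl fun k _ => ?_
    rw [hα, hγ, mul_add, ← hmul, mul_pow, mul_pow, hpow, hpow]
    push_cast
    ring
  have hlow := sum_rpow_neg_ge (p := υ₁ + υ₂) (by positivity) h3.ne (K + 1)
  have hK : (1 : ℝ) + ((K + 1 : ℕ) : ℝ) = K + 2 := by push_cast; ring
  rw [hK] at hlow
  have hp : 0 < υ₁ + 3 * υ₂ - 1 := sub_pos.mpr h4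
  have hq : 0 < 2 * (υ₁ + υ₂) - 1 := sub_pos.mpr h5
  have hr : 0 < 1 - (υ₁ + υ₂) := sub_pos.mpr h3
  have hD : 0 < ((K : ℝ) + 2) ^ (1 - (υ₁ + υ₂)) - 1 :=
    sub_pos.mpr (Real.one_lt_rpow (by linarith [K.cast_nonneg (α := ℝ)]) hr)
  set A := 2 * δ₀ / (c₁ * α₀ * γ₀)
    + (υ₁ + 3 * υ₂) * (c₃ * γ₀) ^ 2 / (υ₁ + 3 * υ₂ - 1)
    + 2 * (υ₁ + υ₂) * c₂ * α₀ * γ₀ * L / c₁ / (2 * (υ₁ + υ₂) - 1) with hA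
  have hA_nonneg : 0 ≤ A := by positivity
  have hnum : ∑ k ∈ Finset.range (K + 1), α k * γ k * u k ≤ α₀ * γ₀ * A := by
    calc ∑ k ∈ Finset.range (K + 1), α k * γ k * u k
        ≤ 2 / c₁ * δ₀
          + c₃ ^ 2 * (α₀ * γ₀ ^ 3 * ((υ₁ + 3 * υ₂) / (υ₁ + 3 * υ₂ - 1)))
          + c₂ * L / c₁ * (α₀ ^ 2 * γ₀ ^ 2 * (2 * (υ₁ + υ₂) / (2 * (υ₁ + υ₂) - 1))) := by
          refine (hineq K).trans ?_
          rw [hsum₁, hsum₂]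
          gcongr
          · exact sum_rpow_neg_le h4 K
          · exact sum_rpow_neg_le h5 K
      _ = α₀ * γ₀ * A := by
          rw [hA]
          field_simp
  set D := ((K : ℝ) + 2) ^ (1 - (υ₁ + υ₂)) - 1
  have hDr : 0 < D / (1 - (υ₁ + υ₂)) := div_pos hD hr
  rw [hsum, div_le_iff₀ (mul_pos (by positivity) (hDr.trans_le hlow))]
  calc _ ≤ α₀ * γ₀ * A := hnum
    _ = (1 - (υ₁ + υ₂)) / D * A * (α₀ * γ₀ * (D / (1 - (υ₁ + υ₂)))) := by
        field_simp
    _ ≤ _ := by gcongr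
end
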